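/- Let A_S be a two-dimensional Artin group of hyperbolic type with exponent matrix M. Then for all s ≠ t in S with M s t = m < ∞, the canonical homomorphism from the dihedral Artin group A_m on generators s, t to A_S (sending s to the image of s and t to the image of t) is injective. Moreover, for every s ∈ S, the image of s in A_S has infinite order (the canonical homomorphism ℤ → A_S, 1 ↦ s, is injective). -/

import Mathlib

/-- The alternating product `a b a b ⋯` with `k` letters, starting with `a`. -/
def altProd {G : Type*} [Monoid G] (a b : G) : ℕ → G
  | 0 => 1
  | n + 1 => a * altProd b a n

/-- The braid relators `prod(s,t;m) (prod(t,s;m))⁻¹` for all pairs `s ≠ t` with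
`M s t = m < ∞`, in the free group on `S`. -/
def artinRels {S : Type} (M : S → S → ℕ∞) : Set (FreeGroup S) :=
  {r | ∃ (s t : S) (m : ℕ), s ≠ t ∧ M s t = (m : ℕ∞) ∧
    r = altProd (FreeGroup.of s) (FreeGroup.of t) m *
        (altProd (FreeGroup.of t) (FreeGroup.of s) m)⁻¹}

/-- The Artin group with exponent matrix `M`. -/
abbrev ArtinGroup {S : Type} (M : S → S → ℕ∞) : Type := PresentedGroup (artinRels M)

/-- The image in the Artin group of the generator `s ∈ S`. -/
def Agen {S : Type} (M : S → S → ℕ∞) (s : S) : ArtinGroup M := PresentedGroup.of s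

/-- `1/m` as a real number, for `m ∈ {2, 3, …, ∞}`, with the convention `1/∞ = 0`. -/
noncomputable def expInv (n : ℕ∞) : ℝ := ((n.toNat : ℕ) : ℝ)⁻¹

/-- The braid relation `prod(s,t;m) = prod(t,s;m)` for the dihedral Artin group. -/
def braidRels (m : ℕ) : Set (FreeGroup (Fin 2)) :=
  {altProd (FreeGroup.of 0) (FreeGroup.of 1) m * (altProd (FreeGroup.of 1) (FreeGroup.of 0) m)⁻¹}

/-- The dihedral Artin group `⟨s, t | prod(s,t;m) = prod(t,s;m)⟩`. -/
abbrev DihedralArtin (m : ℕ) : Type := PresentedGroup (braidRels m)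

/-- The generators of the dihedral Artin group: `s = Dgen m 0` and `t = Dgen m 1`. -/
def Dgen (m : ℕ) (i : Fin 2) : DihedralArtin m := PresentedGroup.of i

lemma Function.End.one_apply' {α : Type*} (x : α) : (1 : Function.End α) x = x := rfl

lemma Function.End.mul_apply' {α : Type*} (f g : Function.End α) (x : α) :
    (f * g) x = f (g x) := rfl

namespace CoxeterSystem

variable {B W : Type*} [Group W] {M : CoxeterMatrix B} (cs : CoxeterSystem M W)

open Classical in
/-- The action of a simple reflection on pairs (group element, sign): it conjugates the element
and flips the sign exactly when the element is the simple reflection itself. -/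
noncomputable def signAction (i : B) : Function.End (W × ZMod 2) := fun p ↦
  (cs.simple i * p.1 * cs.simple i, p.2 + if p.1 = cs.simple i then 1 else 0)

lemma simple_mul_pow_eq (i j : B) (k : ℕ) :
    cs.simple j * (cs.simple i * cs.simple j) ^ k =
      ((cs.simple i * cs.simple j) ^ k)⁻¹ * cs.simple j := by
  induction k with
  | zero => simp
  | succ k ih =>
    rw [pow_succ, ← mul_assoc, ih, ← pow_succ, pow_succ']
    simp [mul_assoc]

open Classical in
lemma signAction_mul_pow_apply (i j : B) (k : ℕ) (r : W) (e : ZMod 2) :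
    ((cs.signAction i * cs.signAction j) ^ k) (r, e) =
      ((cs.simple i * cs.simple j) ^ k * r * ((cs.simple i * cs.simple j) ^ k)⁻¹,
        e + ∑ l ∈ Finset.range (2 * k),
          if r = cs.simple j * (cs.simple i * cs.simple j) ^ l then 1 else 0) := by
  induction k with
  | zero => simp [Function.End.one_apply']
  | succ k ih =>
    have h1 : ∀ g : W, (g * r * g⁻¹ = cs.simple j) ↔ r = g⁻¹ * cs.simple j * g := by
      intro g
      constructor
      · intro h; rw [← h]; group
      · rintro rfl; group
    have h2 : ∀ g : W, (cs.simple j * (g * r * g⁻¹) * cs.simple j = cs.simple i) ↔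
        r = g⁻¹ * cs.simple j * (cs.simple i * cs.simple j) * g := by
      intro g
      constructor
      · intro h; rw [← h]; simp [mul_assoc]
      · rintro rfl; simp [mul_assoc]
    rw [pow_succ', Function.End.mul_apply', ih, Function.End.mul_apply']
    simp only [signAction, h1, h2, ← cs.simple_mul_pow_eq]
    rw [show 2 * (k + 1) = 2 * k + 1 + 1 by ring, Finset.sum_range_succ, Finset.sum_range_succ]
    refine Prod.ext ?_ ?_
    · simp [pow_succ', mul_assoc]
    · have h3 : (cs.simple i * cs.simple j) ^ k * (cs.simple i * cs.simple j) ^ k =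
        (cs.simple i * cs.simple j) ^ (2 * k) := by rw [← pow_add, two_mul]
      have h4 : (cs.simple i * cs.simple j) ^ k *
          ((cs.simple i * cs.simple j) * (cs.simple i * cs.simple j) ^ k) =
        (cs.simple i * cs.simple j) ^ (2 * k + 1) := by
          rw [← pow_succ', ← pow_add]; congr 1; ring
      simp only [mul_assoc] at h3 h4
      simp only [mul_assoc, h3, h4, add_assoc]

lemma isLiftable_signAction : M.IsLiftable cs.signAction := by
  classical
  intro i j
  funext ⟨r, e⟩
  rw [signAction_mul_pow_apply, two_mul, Finset.sum_range_add]
  simp only [pow_add, cs.simple_mul_simple_pow, one_mul]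
  rw [CharTwo.add_self_eq_zero]
  simp [Function.End.one_apply']

/-- The homomorphism given by the action of `W` on pairs (group element, sign). -/
noncomputable def signHom : W →* Function.End (W × ZMod 2) :=
  cs.lift ⟨cs.signAction, cs.isLiftable_signAction⟩

/-- The reflection cocycle: for a reflection `r`, it is `1` exactly when `r` is a right
inversion of `w`. -/
noncomputable def inversionSign (w r : W) : ZMod 2 := (cs.signHom w (r, 0)).2

lemma signHom_simple (i : B) : cs.signHom (cs.simple i) = cs.signAction i :=
  cs.lift_apply_simple _ i

lemma signHom_apply (w r : W) (e : ZMod 2) :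
    cs.signHom w (r, e) = (w * r * w⁻¹, e + cs.inversionSign w r) := by
  unfold inversionSign
  induction w using cs.simple_induction_left generalizing r e with
  | one => simp [Function.End.one_apply']
  | mul_simple_left w i ih =>
    rw [map_mul, Function.End.mul_apply', Function.End.mul_apply', ih, ih r 0,
      signHom_simple]
    simp [signAction, mul_assoc, add_assoc]

@[simp] lemma inversionSign_one (r : W) : cs.inversionSign 1 r = 0 := by
  simp [inversionSign, Function.End.one_apply']

lemma inversionSign_mul (w v r : W) :
    cs.inversionSign (w * v) r = cs.inversionSign v r + cs.inversionSign w (v * r * v⁻¹) := by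
  rw [inversionSign, map_mul, Function.End.mul_apply', signHom_apply,
    signHom_apply]
  simp

open Classical in
lemma inversionSign_simple (i : B) (r : W) :
    cs.inversionSign (cs.simple i) r = if r = cs.simple i then 1 else 0 := by
  simp [inversionSign, signHom_simple, signAction]

lemma inversionSign_inv (w r : W) :
    cs.inversionSign w⁻¹ (w * r * w⁻¹) = cs.inversionSign w r := by
  have h := cs.inversionSign_mul w⁻¹ w r
  rw [inv_mul_cancel, inversionSign_one] at h
  exact (CharTwo.add_eq_zero.mp h.symm).symm

lemma length_mul_lt_of_inversionSign_ne_zero {w r : W} (h : cs.inversionSign w r ≠ 0) :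
    cs.length (w * r) < cs.length w := by
  classical
  induction hn : cs.length w using Nat.strong_induction_on generalizing w r with
  | _ n ih =>
    subst hn
    have hw : w ≠ 1 := by rintro rfl; simp at h
    obtain ⟨i, hi⟩ := cs.exists_rightDescent_of_ne_one hw
    unfold IsRightDescent at hi
    have hwi : w = w * cs.simple i * cs.simple i := by simp
    by_cases hr : r = cs.simple i
    · rwa [hr]
    · rw [hwi, inversionSign_mul, inversionSign_simple, if_neg hr, zero_add] at h
      have h1 := ih _ hi h rfl
      have h2 := cs.length_mul_le (w * cs.simple i * (cs.simple i * r * (cs.simple i)⁻¹))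
        (cs.simple i)
      rw [cs.length_simple] at h2
      have h3 : w * cs.simple i * (cs.simple i * r * (cs.simple i)⁻¹) * cs.simple i = w * r := by
        simp [mul_assoc]
      rw [h3] at h2
      omega

end CoxeterSystem

namespace CoxeterMatrix

variable {B : Type*} (M : CoxeterMatrix B)

open Real Polynomial.Chebyshev Module

/-- The simple coroot of the standard geometric representation, as a linear functional. -/
noncomputable def simpleCoroot (i : B) : Dual ℝ (B →₀ ℝ) :=
  Finsupp.linearCombination ℝ fun j ↦ -2 * cos (π / M i j)

lemma simpleCoroot_single (i j : B) :
    M.simpleCoroot i (Finsupp.single j 1) = -2 * cos (π / M i j) := by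
  simp [simpleCoroot]

lemma simpleCoroot_self (i : B) : M.simpleCoroot i (Finsupp.single i 1) = 2 := by
  simp [simpleCoroot_single]

/-- The reflection by which a generator acts in the standard geometric representation. -/
noncomputable def geomReflection (i : B) : (B →₀ ℝ) ≃ₗ[ℝ] (B →₀ ℝ) :=
  reflection (M.simpleCoroot_self i)

lemma two_mul_cos_two_mul_eq (i j : B) :
    2 * cos (2 * π / M i j) =
      M.simpleCoroot i (Finsupp.single j 1) * M.simpleCoroot j (Finsupp.single i 1) - 2 := by
  rw [simpleCoroot_single, simpleCoroot_single, M.symmetric j i, mul_div_assoc, cos_two_mul]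
  ring

lemma sin_two_pi_div_pos {m : ℕ} (hm : 3 ≤ m) : 0 < sin (2 * π / m) := by
  have hm' : (3 : ℝ) ≤ m := by exact_mod_cast hm
  apply sin_pos_of_pos_of_lt_pi
  · positivity
  · rw [div_lt_iff₀ (by linarith)]
    nlinarith [pi_pos]

lemma geomReflection_mul_pow_of_three_le (i j : B) (h : 3 ≤ M i j) :
    (M.geomReflection i * M.geomReflection j) ^ M i j = 1 := by
  have hs := sin_two_pi_div_pos h
  obtain ⟨m, hm⟩ : ∃ m, M i j = m := ⟨_, rfl⟩
  have ht := M.two_mul_cos_two_mul_eq i j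
  rw [hm] at hs ht h ⊢
  have hS (n : ℤ) := S_two_mul_real_cos (2 * π / m) n
  have hm0 : (m : ℝ) ≠ 0 := by positivity
  have key : ∀ z : ℝ, z * sin (2 * π / m) = 0 → z = 0 := fun z hz ↦
    (mul_eq_zero.mp hz).resolve_right hs.ne'
  ext1 z
  simp only [geomReflection]
  rw [reflection_mul_reflection_pow_apply _ _ m z _ ht]
  have heven (k : ℤ) (hk : m = 2 * k) : (S ℝ (k - 1)).eval (2 * cos (2 * π / m)) = 0 := by
    apply key
    have hk' : (m : ℝ) = 2 * k := by exact_mod_cast hk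
    have : ((k - 1 : ℤ) + 1 : ℝ) * (2 * π / m) = π := by
      push_cast
      rw [sub_add_cancel]
      field_simp
      rw [hk']
      ring
    rw [hS, this, sin_pi]
  have hodd (k : ℤ) (hk : m = 2 * k + 1) : (S ℝ k).eval (2 * cos (2 * π / m)) +
      (S ℝ (k - 1)).eval (2 * cos (2 * π / m)) = 0 := by
    apply key
    have hk' : (m : ℝ) = 2 * k + 1 := by exact_mod_cast hk
    have : ((k - 1 : ℤ) + 1 : ℝ) * (2 * π / m) = 2 * π - (k + 1 : ℝ) * (2 * π / m) := by
      push_cast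
      rw [sub_add_cancel]
      field_simp
      rw [hk']
      ring
    rw [add_mul, hS, hS, this, sin_two_pi_sub, add_neg_cancel]
  rcases Int.even_or_odd' m with ⟨k, hk | hk⟩
  · rw [show ((m : ℤ) - 2) / 2 = k - 1 by omega, show ((m : ℤ) - 1) / 2 = k - 1 by omega,
      heven k hk]
    simp
  · rw [show ((m : ℤ) - 2) / 2 = k - 1 by omega, show ((m : ℤ) - 1) / 2 = k by omega,
      show ((m : ℤ) - 3) / 2 = k - 1 by omega, show (m : ℤ) / 2 = k by omega, hodd k hk]
    simp

lemma isLiftable_geomReflection : M.IsLiftable M.geomReflection := by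
  intro i j
  by_cases hij : i = j
  · subst hij
    rw [M.diagonal, pow_one]
    exact LinearEquiv.ext fun z ↦ involutive_reflection (M.simpleCoroot_self i) z
  rcases Nat.lt_or_ge (M i j) 3 with h | h
  · have h1 := M.off_diagonal i j hij
    obtain h0 | h2 : M i j = 0 ∨ M i j = 2 := by omega
    · rw [h0, pow_zero]
    · rw [h2]
      have e1 : M.simpleCoroot i (Finsupp.single j 1) = 0 := by
        simp [simpleCoroot_single, h2]
      have e2 : M.simpleCoroot j (Finsupp.single i 1) = 0 := by
        simp [simpleCoroot_single, M.symmetric j i, h2]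
      have e3 := M.simpleCoroot_self i
      have e4 := M.simpleCoroot_self j
      ext1 z
      simp only [geomReflection, pow_two, LinearEquiv.mul_apply, reflection_apply, map_sub,
        map_smul, e1, e2, e3, e4, LinearEquiv.coe_one, id]
      module
  · exact M.geomReflection_mul_pow_of_three_le i j h

lemma geomReflection_mul_pow_ne_one {i j : B} (hij : i ≠ j) {k : ℕ} (hk : 0 < k)
    (hkm : k < M i j) : (M.geomReflection i * M.geomReflection j) ^ k ≠ 1 := by
  intro h
  have h1 := M.off_diagonal i j hij
  have hz := LinearEquiv.congr_fun h (Finsupp.single i 1)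
  obtain ⟨m, hm⟩ : ∃ m, M i j = m := ⟨_, rfl⟩
  have ht := M.two_mul_cos_two_mul_eq i j
  simp only [geomReflection] at hz
  have hji : M.simpleCoroot j (Finsupp.single i 1) = -2 * cos (π / m) := by
    rw [simpleCoroot_single, M.symmetric j i, hm]
  rw [reflection_mul_reflection_pow_apply_self _ _ k _ ht] at hz
  simp only [hji, hm] at hz
  rw [hm] at hkm h1
  have hi := DFunLike.congr_fun hz i
  have hj := DFunLike.congr_fun hz j
  simp [hij, Ne.symm hij] at hi hj
  rcases Nat.lt_or_ge m 3 with h3 | h3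
  · have hm2 : m = 2 := by omega
    have hk1 : k = 1 := by omega
    rw [hm2, hk1] at hi
    norm_num [S_zero, S_one] at hi
  have hs := sin_two_pi_div_pos h3
  have hm0 : (0 : ℝ) < m := by positivity
  have hc : cos (π / m) ≠ 0 := by
    apply ne_of_gt
    apply cos_pos_of_mem_Ioo
    constructor
    · have : 0 < π / m := by positivity
      linarith [pi_pos]
    · have : (3 : ℝ) ≤ m := by exact_mod_cast h3
      rw [div_lt_iff₀ hm0]
      nlinarith [pi_pos]
  have h0 : (S ℝ ((k : ℤ) - 1)).eval (2 * cos (2 * π / m)) = 0 := by tauto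
  rw [h0, add_zero] at hi
  have hS := S_two_mul_real_cos (2 * π / m) ((k : ℤ) - 1)
  have hS' := S_two_mul_real_cos (2 * π / m) (k : ℤ)
  rw [h0, zero_mul] at hS
  push_cast at hS hS'
  rw [sub_add_cancel] at hS
  rw [hi, one_mul, add_mul, sin_add, ← hS, zero_mul, zero_add, one_mul] at hS'
  have hcos : cos (k * (2 * π / m)) = 1 := by
    apply mul_right_cancel₀ hs.ne'
    rw [← hS', one_mul]
  have hlt : (k : ℝ) < m := by exact_mod_cast hkm
  have hk' : (0 : ℝ) < k := by exact_mod_cast hk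
  rw [cos_eq_one_iff_of_lt_of_lt] at hcos
  · have : 0 < k * (2 * π / m) := by positivity
    linarith
  · have : 0 < k * (2 * π / m) := by positivity
    linarith [pi_pos]
  · rw [← mul_div_assoc, div_lt_iff₀ hm0]
    nlinarith [pi_pos]

end CoxeterMatrix

namespace CoxeterSystem

variable {B W : Type*} [Group W] {M : CoxeterMatrix B} (cs : CoxeterSystem M W)

lemma orderOf_simple_mul_simple {i j : B} (hij : i ≠ j) (h : M i j ≠ 0) :
    orderOf (cs.simple i * cs.simple j) = M i j := by
  rw [orderOf_eq_iff (Nat.pos_of_ne_zero h)]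
  refine ⟨cs.simple_mul_simple_pow i j, fun k hk hk0 he ↦ ?_⟩
  apply M.geomReflection_mul_pow_ne_one hij hk0 hk
  have := congrArg (cs.lift ⟨M.geomReflection, M.isLiftable_geomReflection⟩) he
  simpa [cs.lift_apply_simple M.isLiftable_geomReflection] using this

lemma simple_injective : Function.Injective cs.simple := by
  intro i j he
  by_contra hij
  have h := congrArg (cs.lift ⟨M.geomReflection, M.isLiftable_geomReflection⟩) he
  rw [cs.lift_apply_simple M.isLiftable_geomReflection,
    cs.lift_apply_simple M.isLiftable_geomReflection] at h
  have h1 := DFunLike.congr_fun (LinearEquiv.congr_fun h (Finsupp.single i 1)) i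
  simp [CoxeterMatrix.geomReflection, Module.reflection_apply, Ne.symm hij] at h1
  norm_num at h1

end CoxeterSystem

/-- The alternating word in two involutions `s` and `t` indexed by an integer: for `j ≥ 0` it has
`j` letters and ends with `t`, for `j ≤ 0` it has `-j` letters and ends with `s`. -/
def dihWord {G : Type*} [Group G] (s t : G) (j : ℤ) : G :=
  if Even j then (s * t) ^ (j / 2) else t * (s * t) ^ (j / 2)

section DihWord

variable {G : Type*} [Group G] {s t : G}

lemma dihWord_two_mul (s t : G) (i : ℤ) : dihWord s t (2 * i) = (s * t) ^ i := by
  simp [dihWord]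

lemma dihWord_two_mul_add_one (s t : G) (i : ℤ) :
    dihWord s t (2 * i + 1) = t * (s * t) ^ i := by
  have h : (2 * i + 1) / 2 = i := by omega
  simp [dihWord, h]

lemma dihWord_zero (s t : G) : dihWord s t 0 = 1 := by simp [dihWord]

lemma dihWord_one (s t : G) : dihWord s t 1 = t := by
  simpa using dihWord_two_mul_add_one s t 0

lemma dihWord_add_two_mul (s t : G) (j n : ℤ) :
    dihWord s t (j + 2 * n) = dihWord s t j * (s * t) ^ n := by
  rcases Int.even_or_odd' j with ⟨i, rfl | rfl⟩
  · rw [← mul_add, dihWord_two_mul, dihWord_two_mul, zpow_add]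
  · rw [show 2 * i + 1 + 2 * n = 2 * (i + n) + 1 by ring, dihWord_two_mul_add_one,
      dihWord_two_mul_add_one, zpow_add, mul_assoc]

lemma mul_dihWord_even (s t : G) {j : ℤ} (hj : Even j) :
    t * dihWord s t j = dihWord s t (j + 1) := by
  obtain ⟨i, rfl⟩ := hj.exists_two_nsmul
  simp only [nsmul_eq_mul, Nat.cast_ofNat]
  rw [dihWord_two_mul, dihWord_two_mul_add_one]

lemma mul_dihWord_odd (s t : G) {j : ℤ} (hj : Odd j) :
    s * dihWord s t j = dihWord s t (j + 1) := by
  obtain ⟨i, rfl⟩ := hj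
  rw [show 2 * i + 1 + 1 = 2 * (1 + i) by ring, dihWord_two_mul, dihWord_two_mul_add_one,
    zpow_add, zpow_one, mul_assoc]

lemma mul_dihWord_even' (hs : s * s = 1) {j : ℤ} (hj : Even j) :
    s * dihWord s t j = dihWord s t (j - 1) := by
  have h := mul_dihWord_odd s t (j := j - 1) (by grind)
  rw [sub_add_cancel] at h
  rw [← h, ← mul_assoc, hs, one_mul]

lemma mul_dihWord_odd' (ht : t * t = 1) {j : ℤ} (hj : Odd j) :
    t * dihWord s t j = dihWord s t (j - 1) := by
  have h := mul_dihWord_even s t (j := j - 1) (by grind)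
  rw [sub_add_cancel] at h
  rw [← h, ← mul_assoc, ht, one_mul]

lemma zpow_mul_eq_mul_zpow_neg (hs : s * s = 1) (ht : t * t = 1) (i : ℤ) :
    (s * t) ^ i * t = t * (s * t) ^ (-i) := by
  have h : SemiconjBy t (s * t)⁻¹ (s * t) := by
    rw [SemiconjBy, mul_inv_rev, inv_eq_of_mul_eq_one_left hs, inv_eq_of_mul_eq_one_left ht,
      ← mul_assoc, ht, one_mul, mul_assoc, ht, mul_one]
  have h2 := h.zpow_right i
  rw [inv_zpow'] at h2
  exact h2.symm

lemma dihWord_mul_right (hs : s * s = 1) (ht : t * t = 1) (j : ℤ) :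
    dihWord s t j * t = dihWord s t (1 - j) := by
  rcases Int.even_or_odd' j with ⟨i, rfl | rfl⟩
  · rw [show 1 - 2 * i = 2 * (-i) + 1 by ring, dihWord_two_mul, dihWord_two_mul_add_one,
      zpow_mul_eq_mul_zpow_neg hs ht]
  · rw [show 1 - (2 * i + 1) = 2 * (-i) by ring, dihWord_two_mul, dihWord_two_mul_add_one,
      mul_assoc, zpow_mul_eq_mul_zpow_neg hs ht, ← mul_assoc, ht, one_mul]

lemma dihWord_swap (hs : s * s = 1) (ht : t * t = 1) (j : ℤ) :
    dihWord t s j = dihWord s t (-j) := by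
  have h : t * s = (s * t)⁻¹ := by
    rw [mul_inv_rev, inv_eq_of_mul_eq_one_left hs, inv_eq_of_mul_eq_one_left ht]
  rcases Int.even_or_odd' j with ⟨i, rfl | rfl⟩
  · rw [show -(2 * i) = 2 * (-i) by ring, dihWord_two_mul, dihWord_two_mul, h, inv_zpow']
  · rw [show -(2 * i + 1) = 2 * (-1 + -i) + 1 by ring, dihWord_two_mul_add_one,
      dihWord_two_mul_add_one, h, inv_zpow', zpow_add, zpow_neg_one, ← h, ← mul_assoc,
      ← mul_assoc, ht, one_mul]

lemma dihWord_mul_left (hs : s * s = 1) (ht : t * t = 1) (j : ℤ) :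
    dihWord s t j * s = dihWord s t (-1 - j) := by
  have h := dihWord_mul_right ht hs (-j)
  rw [dihWord_swap hs ht, dihWord_swap hs ht, neg_neg] at h
  rw [h]
  congr 1
  ring

lemma dihWord_inj_of_even {m : ℕ} (hm : orderOf (s * t) = m) {i j : ℤ} (hij : Even (i - j))
    (h : dihWord s t i = dihWord s t j) : (2 * m : ℤ) ∣ i - j := by
  obtain ⟨n, hn⟩ := hij.exists_two_nsmul
  simp only [nsmul_eq_mul, Nat.cast_ofNat] at hn
  have hi : i = j + 2 * n := by linarith
  rw [hi, dihWord_add_two_mul, mul_eq_left, ← orderOf_dvd_iff_zpow_eq_one, hm] at h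
  rw [hn]
  exact mul_dvd_mul_left 2 h

lemma exists_dihWord_eq_of_mem_closure (hs : s * s = 1) (ht : t * t = 1) {u : G}
    (hu : u ∈ Subgroup.closure {s, t}) : ∃ j, u = dihWord s t j := by
  have key : ∀ x ∈ ({s, t} : Set G), ∀ j, ∃ k, x * dihWord s t j = dihWord s t k := by
    rintro x (rfl | rfl) j
    · rcases Int.even_or_odd j with hj | hj
      · exact ⟨_, mul_dihWord_even' hs hj⟩
      · exact ⟨_, mul_dihWord_odd _ _ hj⟩
    · rcases Int.even_or_odd j with hj | hj
      · exact ⟨_, mul_dihWord_even _ _ hj⟩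
      · exact ⟨_, mul_dihWord_odd' ht hj⟩
  induction hu using Subgroup.closure_induction_left with
  | one => exact ⟨0, (dihWord_zero s t).symm⟩
  | mul_left x hx y hy ih =>
    obtain ⟨j, rfl⟩ := ih
    exact key x hx j
  | inv_mul_cancel x hx y hy ih =>
    obtain ⟨j, rfl⟩ := ih
    obtain rfl | rfl := hx
    · rw [inv_eq_of_mul_eq_one_left hs]
      exact key _ (by simp) j
    · rw [inv_eq_of_mul_eq_one_left ht]
      exact key _ (by simp) j

lemma exists_dihWord_eq_of_mem_closure_of_orderOf (hs : s * s = 1) (ht : t * t = 1) {m : ℕ}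
    (hm : orderOf (s * t) = m) (hm0 : m ≠ 0) {u : G} (hu : u ∈ Subgroup.closure {s, t}) :
    ∃ j : ℤ, -m ≤ j ∧ j < m ∧ u = dihWord s t j := by
  obtain ⟨j, rfl⟩ := exists_dihWord_eq_of_mem_closure hs ht hu
  have hpos : (0 : ℤ) < 2 * m := by omega
  refine ⟨(j + m) % (2 * m) - m, ?_, ?_, ?_⟩
  · have := Int.emod_nonneg (j + m) hpos.ne'
    omega
  · have := Int.emod_lt_of_pos (j + m) hpos
    omega
  · have h : j = (j + m) % (2 * m) - m + 2 * (m * ((j + m) / (2 * m))) := by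
      have := Int.emod_add_mul_ediv (j + m) (2 * m)
      linarith
    conv_lhs => rw [h]
    rw [dihWord_add_two_mul, zpow_mul, zpow_natCast, ← hm, pow_orderOf_eq_one, one_zpow, mul_one]

end DihWord

namespace CoxeterSystem

variable {B W : Type*} [Group W] {M : CoxeterMatrix B} (cs : CoxeterSystem M W) {a b : B}

lemma inversionSign_dihWord (hab : a ≠ b) (h0 : M a b ≠ 0) {n : ℕ} (hn : n + 1 ≤ M a b) :
    cs.inversionSign (dihWord (cs.simple a) (cs.simple b) (n + 1)) (cs.simple b) = 1 := by
  have hs := cs.simple_mul_simple_self a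
  have ht := cs.simple_mul_simple_self b
  have hm := cs.orderOf_simple_mul_simple hab h0
  induction n with
  | zero => simp [dihWord_one, inversionSign_simple]
  | succ n ih =>
    have ih := ih (by omega)
    push_cast
    have hstep : ∃ c : B, dihWord (cs.simple a) (cs.simple b) (n + 1 + 1) =
        cs.simple c * dihWord (cs.simple a) (cs.simple b) (n + 1) := by
      rcases Int.even_or_odd ((n : ℤ) + 1) with h | h
      · exact ⟨b, (mul_dihWord_even _ _ h).symm⟩
      · exact ⟨a, (mul_dihWord_odd _ _ h).symm⟩
    obtain ⟨c, hc⟩ := hstep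
    rw [hc, inversionSign_mul, ih, inversionSign_simple, if_neg, add_zero]
    intro he
    have he' := mul_inv_eq_iff_eq_mul.mp he
    rw [← hc, dihWord_mul_right hs ht] at he'
    have hd := dihWord_inj_of_even hm (by use -(n + 1); ring) he'
    have := Int.le_of_dvd (by omega) ((dvd_neg).mpr hd)
    omega

lemma exists_dihWord_eq_of_inversionSign_eq_zero (hab : a ≠ b) (h0 : M a b ≠ 0) {u : W}
    (hu : u ∈ Subgroup.closure {cs.simple a, cs.simple b})
    (h : cs.inversionSign u (cs.simple a) = 0) :
    ∃ j : ℕ, j < M a b ∧ u = dihWord (cs.simple a) (cs.simple b) j := by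
  have hs := cs.simple_mul_simple_self a
  have ht := cs.simple_mul_simple_self b
  obtain ⟨j, hj1, hj2, rfl⟩ := exists_dihWord_eq_of_mem_closure_of_orderOf hs ht
    (cs.orderOf_simple_mul_simple hab h0) h0 hu
  rcases lt_or_ge j 0 with hj | hj
  · exfalso
    obtain ⟨n, hn⟩ : ∃ n : ℕ, j = -(n + 1) := ⟨(-j - 1).toNat, by omega⟩
    have h1 := cs.inversionSign_dihWord hab.symm (by rwa [M.symmetric]) (n := n)
      (by rw [M.symmetric]; omega)
    rw [dihWord_swap hs ht, ← hn, h] at h1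
    exact zero_ne_one h1
  · lift j to ℕ using hj
    exact ⟨j, by omega, rfl⟩

lemma eq_one_of_inversionSign_eq_zero (hab : a ≠ b) (h0 : M a b ≠ 0) {u : W}
    (hu : u ∈ Subgroup.closure {cs.simple a, cs.simple b})
    (ha : cs.inversionSign u (cs.simple a) = 0) (hb : cs.inversionSign u (cs.simple b) = 0) :
    u = 1 := by
  obtain ⟨j, hj, rfl⟩ := cs.exists_dihWord_eq_of_inversionSign_eq_zero hab h0 hu ha
  rcases j with _ | n
  · simp [dihWord_zero]
  · have h1 := cs.inversionSign_dihWord hab h0 (n := n) (by omega)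
    push_cast at hb
    rw [hb] at h1
    exact absurd h1 zero_ne_one

/-- `d` has no left inversion in the subgroup `D`. -/
def IsLeftMinimal (D : Subgroup W) (d : W) : Prop := ∀ q ∈ D, cs.inversionSign d⁻¹ q = 0

lemma exists_isLeftMinimal (D : Subgroup W) (w : W) :
    ∃ u ∈ D, ∃ d, cs.IsLeftMinimal D d ∧ w = u * d := by
  let f : D → ℕ := fun u ↦ cs.length ((u : W)⁻¹ * w)
  let u := Function.argmin f
  refine ⟨u, u.2, (u : W)⁻¹ * w, fun q hq ↦ ?_, by simp⟩
  by_contra hne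
  have h1 := cs.length_mul_lt_of_inversionSign_ne_zero hne
  rw [← cs.length_inv, cs.length_inv (_ * w), mul_inv_rev, inv_inv, ← mul_assoc,
    ← mul_inv_rev] at h1
  exact absurd (Function.argmin_le f (u * ⟨q, hq⟩)) (not_le.mpr h1)

lemma eq_simple_of_mul_eq_mul_simple (hab : a ≠ b) (h0 : M a b ≠ 0) {d r : W} {x : B}
    (hd : cs.IsLeftMinimal (Subgroup.closure {cs.simple a, cs.simple b}) d)
    (hr : r ∈ Subgroup.closure {cs.simple a, cs.simple b}) (h : r * d = d * cs.simple x) :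
    r = cs.simple a ∨ r = cs.simple b := by
  classical
  have key : ∀ q ∈ Subgroup.closure {cs.simple a, cs.simple b},
      cs.inversionSign r q ≠ 0 → q = r := by
    intro q hq hne
    have h1 := cs.inversionSign_mul d⁻¹ r q
    rw [hd _ (mul_mem (mul_mem hr hq) (inv_mem hr)), add_zero] at h1
    have hdr : d⁻¹ * r = cs.simple x * d⁻¹ := by
      rw [inv_mul_eq_iff_eq_mul, ← mul_assoc, ← h, mul_inv_cancel_right]
    rw [← h1, hdr, inversionSign_mul, hd q hq, zero_add, inversionSign_simple, inv_inv] at hne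
    have h2 : d⁻¹ * q * d = cs.simple x := by
      by_contra hc
      exact hne (if_neg hc)
    rw [mul_assoc, inv_mul_eq_iff_eq_mul, ← h] at h2
    exact mul_right_cancel h2
  by_contra! hc
  have h1 : r = 1 := by
    apply cs.eq_one_of_inversionSign_eq_zero hab h0 hr
    · by_contra hne
      exact hc.1 (key _ (Subgroup.subset_closure (by simp)) hne).symm
    · by_contra hne
      exact hc.2 (key _ (Subgroup.subset_closure (by simp)) hne).symm
  rw [h1, one_mul, left_eq_mul] at h
  have := cs.length_simple x
  rw [h, cs.length_one] at this
  exact zero_ne_one this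

end CoxeterSystem

lemma map_altProd {G H : Type*} [Monoid G] [Monoid H] (f : G →* H) (a b : G) (n : ℕ) :
    f (altProd a b n) = altProd (f a) (f b) n := by
  induction n generalizing a b with
  | zero => simp [altProd]
  | succ n ih => simp [altProd, ih]

lemma altProd_mul_inv_altProd {G : Type*} [Group G] {s t : G} (hs : s * s = 1) (ht : t * t = 1)
    (n : ℕ) : altProd s t n * (altProd t s n)⁻¹ = (s * t) ^ n := by
  induction n generalizing s t with
  | zero => simp [altProd]
  | succ n ih =>
    have h : SemiconjBy s (t * s) (s * t) := (mul_assoc s t s).symm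
    rw [altProd, altProd, mul_inv_rev, mul_assoc, ← mul_assoc (altProd t s n), ih ht hs,
      inv_eq_of_mul_eq_one_left ht, ← mul_assoc, (h.pow_right n).eq, pow_succ, mul_assoc]

/-- An alternating product of permutations, evaluated along a trajectory. -/
lemma altProd_perm_apply {P : Type*} (f g : Equiv.Perm P) (n : ℕ) (Y : ℕ → P)
    (h : ∀ i < n, (if Odd (n + i) then f else g) (Y i) = Y (i + 1)) :
    altProd f g n (Y 0) = Y n := by
  induction n generalizing f g with
  | zero => rfl
  | succ n ih =>
    rw [altProd, Equiv.Perm.mul_apply, ih g f]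
    · simpa [show n + 1 + n = 2 * n + 1 by ring] using h n (by omega)
    · intro i hi
      rw [← h i (by omega)]
      congr 1
      by_cases hp : Odd (n + i)
      · rw [if_pos hp, if_neg (by grind)]
      · rw [if_neg hp, if_pos (by grind)]

namespace CoxeterSystem

variable {B W : Type*} [Group W] {M : CoxeterMatrix B} (cs : CoxeterSystem M W)
  {A : Type*} [Group A] (X : Set B) (α : B → A)

/-- The simple reflection `c` fixes the coset `w W_X`, in the sense that `c w = w x` for some
`x ∈ X`. -/
def FixesCoset (c : B) (w : W) : Prop := ∃ x ∈ X, cs.simple c * w = w * cs.simple x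

variable {X} in
lemma fixesCoset_simple_mul {c : B} {w : W} :
    cs.FixesCoset X c (cs.simple c * w) ↔ cs.FixesCoset X c w := by
  simp only [FixesCoset, mul_assoc, mul_right_inj]

open Classical in
/-- The letter of `A` produced when the generator `c` acts at `w`. -/
noncomputable def cosetLabel (c : B) (w : W) : A :=
  if h : cs.FixesCoset X c w then α h.choose else 1

open Classical in
/-- The coset representative reached from `w` by the generator `c`. -/
noncomputable def cosetMove (c : B) (w : W) : W :=
  if cs.FixesCoset X c w then w else cs.simple c * w

lemma cosetMove_cosetMove (c : B) (w : W) :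
    cs.cosetMove X c (cs.cosetMove X c w) = w := by
  by_cases h : cs.FixesCoset X c w
  · simp [cosetMove, h]
  · simp [cosetMove, h, fixesCoset_simple_mul]

/-- The permutation of `W × A` by which the Artin generator `c` acts. -/
noncomputable def cosetPerm (c : B) : Equiv.Perm (W × A) where
  toFun p := (cs.cosetMove X c p.1, cs.cosetLabel X α c p.1 * p.2)
  invFun p := (cs.cosetMove X c p.1, (cs.cosetLabel X α c (cs.cosetMove X c p.1))⁻¹ * p.2)
  left_inv p := by simp [cosetMove_cosetMove]
  right_inv p := by simp [cosetMove_cosetMove]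

variable {X}

lemma cosetPerm_of_mem {c x : B} {w : W} (hx : x ∈ X)
    (h : cs.simple c * w = w * cs.simple x) (g : A) :
    cs.cosetPerm X α c (w, g) = (w, α x * g) := by
  have hf : cs.FixesCoset X c w := ⟨x, hx, h⟩
  have hc : hf.choose = x :=
    cs.simple_injective (mul_left_cancel (hf.choose_spec.2.symm.trans h))
  simp [cosetPerm, cosetMove, cosetLabel, hf, hc]

lemma cosetPerm_of_not {c : B} {w : W} (h : ¬ cs.FixesCoset X c w) (g : A) :
    cs.cosetPerm X α c (w, g) = (cs.simple c * w, g) := by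
  simp [cosetPerm, cosetMove, cosetLabel, h]

variable (X) in
/-- `w` has no right inversion among the simple reflections in `X`. -/
def IsRightMinimal (w : W) : Prop := ∀ x ∈ X, cs.inversionSign w (cs.simple x) = 0

lemma IsRightMinimal.cosetMove {w : W} (hw : cs.IsRightMinimal X w) (c : B) :
    cs.IsRightMinimal X (cs.cosetMove X c w) := by
  classical
  by_cases h : cs.FixesCoset X c w
  · simpa [CoxeterSystem.cosetMove, h] using hw
  · intro x hx
    simp only [CoxeterSystem.cosetMove, h, if_false]
    rw [inversionSign_mul, hw x hx, zero_add, inversionSign_simple, if_neg]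
    intro he
    exact h ⟨x, hx, (mul_inv_eq_iff_eq_mul.mp he).symm⟩

lemma isRightMinimal_cosetPerm_iff (c : B) (p : W × A) :
    cs.IsRightMinimal X (cs.cosetPerm X α c p).1 ↔ cs.IsRightMinimal X p.1 := by
  change cs.IsRightMinimal X (cs.cosetMove X c p.1) ↔ _
  refine ⟨fun h ↦ ?_, fun h ↦ IsRightMinimal.cosetMove cs h c⟩
  simpa only [cosetMove_cosetMove] using IsRightMinimal.cosetMove cs h c

/-- Right minimality passes to the minimal element of a coset `D w`. -/
lemma IsLeftMinimal.isRightMinimal {D : Subgroup W} {u d : W} (hd : cs.IsLeftMinimal D d)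
    (hu : ∀ r ∉ D, cs.inversionSign u r = 0) (hw : cs.IsRightMinimal X (u * d)) :
    cs.IsRightMinimal X d := by
  intro x hx
  by_cases h : d * cs.simple x * d⁻¹ ∈ D
  · rw [← inversionSign_inv]
    exact hd _ h
  · have := hw x hx
    rwa [inversionSign_mul, hu _ h, add_zero] at this

lemma inversionSign_eq_zero_of_notMem {a b : B} {u r : W}
    (hu : u ∈ Subgroup.closure {cs.simple a, cs.simple b})
    (hr : r ∉ Subgroup.closure {cs.simple a, cs.simple b}) : cs.inversionSign u r = 0 := by
  classical
  induction hu using Subgroup.closure_induction generalizing r with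
  | mem x hx =>
    have hx' : r ≠ x := by
      rintro rfl
      exact hr (Subgroup.subset_closure hx)
    obtain rfl | rfl := hx <;> rw [inversionSign_simple, if_neg hx']
  | one => simp
  | mul x y hx hy ihx ihy =>
    rw [inversionSign_mul, ihy hr, zero_add]
    apply ihx
    intro h
    apply hr
    have := mul_mem (mul_mem (inv_mem hy) h) hy
    simpa [mul_assoc] using this
  | inv x hx ih =>
    have h1 := cs.inversionSign_inv x (x⁻¹ * r * x)
    have h2 : x * (x⁻¹ * r * x) * x⁻¹ = r := by group
    rw [h2] at h1
    rw [h1]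
    apply ih
    intro h
    apply hr
    have := mul_mem (mul_mem hx h) (inv_mem hx)
    rwa [h2] at this

lemma altProd_cosetPerm_of_forall_not {a b : B} {d : W}
    (h : ∀ u ∈ Subgroup.closure {cs.simple a, cs.simple b},
      ¬ cs.FixesCoset X a (u * d) ∧ ¬ cs.FixesCoset X b (u * d))
    {u : W} (hu : u ∈ Subgroup.closure {cs.simple a, cs.simple b}) (n : ℕ) (g : A) :
    altProd (cs.cosetPerm X α a) (cs.cosetPerm X α b) n (u * d, g) =
      (altProd (cs.simple a) (cs.simple b) n * (u * d), g) := by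
  have key : ∀ n, altProd (cs.simple a) (cs.simple b) n ∈
      Subgroup.closure {cs.simple a, cs.simple b} ∧
      altProd (cs.simple b) (cs.simple a) n ∈
        Subgroup.closure {cs.simple a, cs.simple b} ∧
      altProd (cs.cosetPerm X α a) (cs.cosetPerm X α b) n (u * d, g) =
        (altProd (cs.simple a) (cs.simple b) n * (u * d), g) ∧
      altProd (cs.cosetPerm X α b) (cs.cosetPerm X α a) n (u * d, g) =
        (altProd (cs.simple b) (cs.simple a) n * (u * d), g) := by
    intro n
    induction n with
    | zero => simp [altProd, one_mem]
    | succ n ih =>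
      obtain ⟨h1, h2, h3, h4⟩ := ih
      refine ⟨mul_mem (Subgroup.subset_closure (by simp)) h2,
        mul_mem (Subgroup.subset_closure (by simp)) h1, ?_, ?_⟩
      · rw [altProd, Equiv.Perm.mul_apply, h4, ← mul_assoc,
          cosetPerm_of_not _ _ (h _ (mul_mem h2 hu)).1, altProd]
        simp only [mul_assoc]
      · rw [altProd, Equiv.Perm.mul_apply, h3, ← mul_assoc,
          cosetPerm_of_not _ _ (h _ (mul_mem h1 hu)).2, altProd]
        simp only [mul_assoc]
  exact (key n).2.2.1

lemma altProd_cosetPerm_of_mem {a b x y : B} {d : W} (hx : x ∈ X) (hy : y ∈ X)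
    (ha : cs.simple a * d = d * cs.simple x) (hb : cs.simple b * d = d * cs.simple y)
    (n : ℕ) (g : A) :
    altProd (cs.cosetPerm X α a) (cs.cosetPerm X α b) n (d, g) =
      (d, altProd (α x) (α y) n * g) := by
  induction n generalizing a b x y with
  | zero => simp [altProd]
  | succ n ih =>
    rw [altProd, Equiv.Perm.mul_apply, ih hy hx hb ha, cosetPerm_of_mem _ _ hx ha, altProd,
      mul_assoc]

end CoxeterSystem

/-- The letter which increases the index of the alternating word `dihWord s t j`. -/
def dihLetter {B : Type*} (a b : B) (j : ℤ) : B := if Even j then b else a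

lemma dihLetter_congr {B : Type*} (a b : B) {i j : ℤ} (h : Even (i - j)) :
    dihLetter a b i = dihLetter a b j := by
  simp only [dihLetter, Int.even_sub.mp h]

namespace CoxeterSystem

variable {B W : Type*} [Group W] {M : CoxeterMatrix B} (cs : CoxeterSystem M W)
  {A : Type*} [Group A] {X : Set B} (α : B → A) {a b : B}

lemma simple_dihLetter_mul_dihWord (j : ℤ) :
    cs.simple (dihLetter a b j) * dihWord (cs.simple a) (cs.simple b) j =
      dihWord (cs.simple a) (cs.simple b) (j + 1) := by
  rcases Int.even_or_odd j with h | h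
  · rw [dihLetter, if_pos h, mul_dihWord_even _ _ h]
  · rw [dihLetter, if_neg (Int.not_even_iff_odd.mpr h), mul_dihWord_odd _ _ h]

lemma simple_mem_closure_pair_left :
    cs.simple a ∈ Subgroup.closure {cs.simple a, cs.simple b} :=
  Subgroup.subset_closure (by simp)

lemma simple_mem_closure_pair_right :
    cs.simple b ∈ Subgroup.closure {cs.simple a, cs.simple b} :=
  Subgroup.subset_closure (by simp)

lemma simple_dihLetter_mem (j : ℤ) :
    cs.simple (dihLetter a b j) ∈ Subgroup.closure {cs.simple a, cs.simple b} := by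
  unfold dihLetter
  split_ifs
  · exact cs.simple_mem_closure_pair_right
  · exact cs.simple_mem_closure_pair_left

lemma dihWord_mem_closure (j : ℤ) : dihWord (cs.simple a) (cs.simple b) j ∈
    Subgroup.closure {cs.simple a, cs.simple b} := by
  have ha := cs.simple_mem_closure_pair_left (a := a) (b := b)
  have hb := cs.simple_mem_closure_pair_right (a := a) (b := b)
  unfold dihWord
  split_ifs
  · exact zpow_mem (mul_mem ha hb) _
  · exact mul_mem hb (zpow_mem (mul_mem ha hb) _)

/-- If the pair `c, u d` fixes a coset, the reflection `u⁻¹ c u` is one of `a`, `b`. -/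
lemma FixesCoset.inv_mul_mul_eq (hab : a ≠ b) (h0 : M a b ≠ 0) {d u : W} {c : B}
    (hd : cs.IsLeftMinimal (Subgroup.closure {cs.simple a, cs.simple b}) d)
    (hu : u ∈ Subgroup.closure {cs.simple a, cs.simple b})
    (hc : cs.simple c ∈ Subgroup.closure {cs.simple a, cs.simple b})
    (h : cs.FixesCoset X c (u * d)) :
    (cs.simple c * u = u * cs.simple a ∧ cs.FixesCoset X a d) ∨
      (cs.simple c * u = u * cs.simple b ∧ cs.FixesCoset X b d) := by
  obtain ⟨x, hx, he⟩ := h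
  have hr : u⁻¹ * cs.simple c * u * d = d * cs.simple x := by
    rw [mul_assoc, mul_assoc, he]
    group
  refine (cs.eq_simple_of_mul_eq_mul_simple hab h0 hd
    (mul_mem (mul_mem (inv_mem hu) hc) hu) hr).imp ?_ ?_ <;>
  · intro h
    exact ⟨by rw [← h]; group, x, hx, by rw [← h, hr]⟩

lemma not_fixesCoset_dihWord_mul (hab : a ≠ b) (h0 : M a b ≠ 0) {d : W}
    (hd : cs.IsLeftMinimal (Subgroup.closure {cs.simple a, cs.simple b}) d)
    (hb : ¬ cs.FixesCoset X b d) {j : ℤ} (hj0 : 0 ≤ j) (hj : j < M a b - 1) :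
    ¬ cs.FixesCoset X (dihLetter a b j) (dihWord (cs.simple a) (cs.simple b) j * d) := by
  intro h
  have hs := cs.simple_mul_simple_self a
  have ht := cs.simple_mul_simple_self b
  rcases FixesCoset.inv_mul_mul_eq cs hab h0 hd (cs.dihWord_mem_closure j)
    (cs.simple_dihLetter_mem j) h with ⟨he, -⟩ | ⟨-, he⟩
  · rw [simple_dihLetter_mul_dihWord, dihWord_mul_left hs ht] at he
    have := Int.le_of_dvd (by omega)
      (dihWord_inj_of_even (cs.orderOf_simple_mul_simple hab h0) (by use j + 1; ring) he)
    omega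
  · exact hb he

lemma altProd_cosetPerm_dihWord (hab : a ≠ b) (h0 : M a b ≠ 0) {d : W} {x : B}
    (hd : cs.IsLeftMinimal (Subgroup.closure {cs.simple a, cs.simple b}) d)
    (hx : x ∈ X) (ha : cs.simple a * d = d * cs.simple x) (hb : ¬ cs.FixesCoset X b d)
    {k : ℕ} (hk : k < M a b) (g : A) :
    altProd (cs.cosetPerm X α a) (cs.cosetPerm X α b) (M a b)
        (dihWord (cs.simple a) (cs.simple b) k * d, g) =
      altProd (cs.cosetPerm X α b) (cs.cosetPerm X α a) (M a b)
        (dihWord (cs.simple a) (cs.simple b) k * d, g) := by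
  have hs := cs.simple_mul_simple_self a
  have ht := cs.simple_mul_simple_self b
  generalize hm : M a b = m at *
  have h0' : M a b ≠ 0 := by rwa [hm]
  set F := dihWord (cs.simple a) (cs.simple b) with hF
  set σ := cs.cosetPerm X α
  have hL : ∀ i j : ℤ, Even (i - j) → dihLetter a b i = dihLetter a b j :=
    fun i j ↦ dihLetter_congr a b
  have hup : ∀ j : ℤ, 0 ≤ j → j < m - 1 → ∀ g,
      σ (dihLetter a b j) (F j * d, g) = (F (j + 1) * d, g) := by
    intro j hj0 hj g
    rw [cosetPerm_of_not _ _ (cs.not_fixesCoset_dihWord_mul hab h0' hd hb hj0 (by rwa [hm])),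
      ← mul_assoc, simple_dihLetter_mul_dihWord]
  have hdown : ∀ j : ℤ, 0 ≤ j → j < m - 1 → ∀ g,
      σ (dihLetter a b j) (F (j + 1) * d, g) = (F j * d, g) := by
    intro j hj0 hj g
    have hn := cs.not_fixesCoset_dihWord_mul hab h0' hd hb hj0 (by rwa [hm])
    rw [← fixesCoset_simple_mul, ← mul_assoc, simple_dihLetter_mul_dihWord] at hn
    rw [cosetPerm_of_not _ _ hn, hF, ← simple_dihLetter_mul_dihWord, ← mul_assoc, ← mul_assoc,
      simple_mul_simple_self, one_mul]
  have htop : ∀ g, σ (dihLetter a b (m - 1)) (F (m - 1) * d, g) = (F (m - 1) * d, α x * g) := by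
    intro g
    apply cosetPerm_of_mem _ _ hx
    rw [← mul_assoc, simple_dihLetter_mul_dihWord, mul_assoc, ← ha, ← mul_assoc,
      dihWord_mul_left hs ht]
    congr 1
    rw [show (m : ℤ) - 1 + 1 = (-1 - (m - 1)) + 2 * m by ring, dihWord_add_two_mul,
      zpow_natCast, ← hm, ← cs.orderOf_simple_mul_simple hab h0', pow_orderOf_eq_one, mul_one]
  have hbot : ∀ g, σ (dihLetter a b (-1)) (F 0 * d, g) = (F 0 * d, α x * g) := by
    intro g
    rw [hF, dihWord_zero, one_mul]
    exact cosetPerm_of_mem _ _ hx ha g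
  let U : ℕ → W × A := fun i ↦
    if k + i < m then (F (k + i) * d, g) else (F (2 * m - 1 - k - i) * d, α x * g)
  let D : ℕ → W × A := fun i ↦
    if i ≤ k then (F (k - i) * d, g) else (F (i - k - 1) * d, α x * g)
  have hU : ∀ i < m, σ (dihLetter a b (k + i)) (U i) = U (i + 1) := by
    intro i hi
    rcases lt_trichotomy (k + i + 1) m with h | h | h
    · simp only [U, if_pos (show k + i < m by omega), if_pos (show k + (i + 1) < m by omega)]
      rw [hup _ (by omega) (by omega)]
      push_cast
      rw [add_assoc]
    · simp only [U, if_pos (show k + i < m by omega), if_neg (show ¬ k + (i + 1) < m by omega)]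
      have e1 : (k + i : ℤ) = m - 1 := by omega
      have e2 : (2 * m - 1 - k - (i + 1 : ℕ) : ℤ) = m - 1 := by omega
      rw [e1, e2, htop]
    · simp only [U, if_neg (show ¬ k + i < m by omega),
        if_neg (show ¬ k + (i + 1) < m by omega)]
      have e1 : (2 * m - 1 - k - i : ℤ) = (2 * m - 1 - k - (i + 1 : ℕ)) + 1 := by omega
      rw [hL (k + i) (2 * m - 1 - k - (i + 1 : ℕ)) ⟨k + i + 1 - m, by push_cast; ring⟩, e1,
        hdown _ (by omega) (by omega)]
  have hD : ∀ i < m, σ (dihLetter a b (k + 1 + i)) (D i) = D (i + 1) := by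
    intro i hi
    rcases lt_trichotomy i k with h | h | h
    · simp only [D, if_pos (show i ≤ k by omega), if_pos (show i + 1 ≤ k by omega)]
      have e1 : (k - i : ℤ) = (k - (i + 1 : ℕ)) + 1 := by omega
      rw [hL (k + 1 + i) (k - (i + 1 : ℕ)) ⟨i + 1, by push_cast; ring⟩, e1,
        hdown _ (by omega) (by omega)]
    · simp only [D, if_pos (show i ≤ k by omega), if_neg (show ¬ i + 1 ≤ k by omega)]
      have e1 : (k - i : ℤ) = 0 := by omega
      have e2 : ((i + 1 : ℕ) - k - 1 : ℤ) = 0 := by omega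
      rw [hL (k + 1 + i) (-1) ⟨k + 1, by push_cast [h]; ring⟩, e1, e2, hbot]
    · simp only [D, if_neg (show ¬ i ≤ k by omega), if_neg (show ¬ i + 1 ≤ k by omega)]
      have e1 : ((i + 1 : ℕ) - k - 1 : ℤ) = (i - k - 1) + 1 := by omega
      rw [hL (k + 1 + i) (i - k - 1) ⟨k + 1, by ring⟩, e1, hup _ (by omega) (by omega)]
  have hU0 : U 0 = (F k * d, g) := by simp [U, hk]
  have hD0 : D 0 = (F k * d, g) := by simp [D]
  have hUD : U m = D m := by
    have e1 : (2 * m - 1 - k - m : ℤ) = m - k - 1 := by ring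
    simp only [U, D, if_neg (show ¬ k + m < m by omega), if_neg (show ¬ m ≤ k by omega), e1]
  have hl : ∀ (n : ℕ) (j : ℤ), Even ((n : ℤ) - j) →
      (if Odd n then σ a else σ b) = σ (dihLetter a b j) := by
    intro n j h
    rw [← hL n j h, dihLetter]
    by_cases hn : Odd n
    · rw [if_pos hn, if_neg (by simpa using hn)]
    · rw [if_neg hn, if_pos (by simpa using hn)]
  have hl' : ∀ (n : ℕ) (j : ℤ), Even ((n : ℤ) - j + 1) →
      (if Odd n then σ b else σ a) = σ (dihLetter a b j) := by
    intro n j h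
    rw [hL j (n + 1) (by grind), dihLetter]
    by_cases hn : Odd n
    · rw [if_pos hn, if_pos (by grind)]
    · rw [if_neg hn, if_neg (by grind)]
  rcases Nat.even_or_odd (m + k) with hp | hp
  · have h1 : altProd (σ a) (σ b) m (U 0) = U m :=
      altProd_perm_apply _ _ _ _ fun i hi ↦ by
        rw [← hU i hi, hl (m + i) (k + i) (by push_cast; grind)]
    have h2 : altProd (σ b) (σ a) m (D 0) = D m :=
      altProd_perm_apply _ _ _ _ fun i hi ↦ by
        rw [← hD i hi, hl' (m + i) (k + 1 + i) (by push_cast; grind)]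
    rw [← hU0, h1, hU0, ← hD0, h2, hUD]
  · have h1 : altProd (σ b) (σ a) m (U 0) = U m :=
      altProd_perm_apply _ _ _ _ fun i hi ↦ by
        rw [← hU i hi, hl' (m + i) (k + i) (by push_cast; grind)]
    have h2 : altProd (σ a) (σ b) m (D 0) = D m :=
      altProd_perm_apply _ _ _ _ fun i hi ↦ by
        rw [← hD i hi, hl (m + i) (k + 1 + i) (by push_cast; grind)]
    rw [← hD0, h2, hD0, ← hU0, h1, hUD]

end CoxeterSystem

namespace CoxeterSystem

variable {B W : Type*} [Group W] {M : CoxeterMatrix B} (cs : CoxeterSystem M W)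
  {A : Type*} [Group A] {X : Set B} (α : B → A) {a b : B}

lemma altProd_simple_comm (a b : B) :
    altProd (cs.simple a) (cs.simple b) (M a b) = altProd (cs.simple b) (cs.simple a) (M a b) := by
  rw [← mul_inv_eq_one, altProd_mul_inv_altProd (cs.simple_mul_simple_self a)
    (cs.simple_mul_simple_self b), simple_mul_simple_pow]

lemma matrix_eq_of_conj (hab : a ≠ b) (h0 : M a b ≠ 0) {x y : B} (hxy : x ≠ y)
    (h0' : M x y ≠ 0) {d : W} (ha : cs.simple a * d = d * cs.simple x)
    (hb : cs.simple b * d = d * cs.simple y) : M x y = M a b := by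
  have h : SemiconjBy d (cs.simple x * cs.simple y) (cs.simple a * cs.simple b) :=
    SemiconjBy.mul_right ha.symm hb.symm
  rw [← cs.orderOf_simple_mul_simple hxy h0', ← cs.orderOf_simple_mul_simple hab h0]
  exact orderOf_eq_orderOf_iff.mpr fun n ↦ by
    have hn := h.pow_right n
    rw [SemiconjBy] at hn
    constructor <;> intro h1
    · rwa [h1, mul_one, right_eq_mul] at hn
    · rwa [h1, one_mul, mul_eq_left] at hn

/-- The permutations `cosetPerm` satisfy the braid relations on right minimal elements. -/
theorem altProd_cosetPerm_comm
    (hα : ∀ x ∈ X, ∀ y ∈ X, x ≠ y → M x y ≠ 0 ∧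
      altProd (α x) (α y) (M x y) = altProd (α y) (α x) (M x y))
    (hab : a ≠ b) (h0 : M a b ≠ 0) {w : W} (hw : cs.IsRightMinimal X w) (g : A) :
    altProd (cs.cosetPerm X α a) (cs.cosetPerm X α b) (M a b) (w, g) =
      altProd (cs.cosetPerm X α b) (cs.cosetPerm X α a) (M a b) (w, g) := by
  obtain ⟨u, hu, d, hd, rfl⟩ :=
    cs.exists_isLeftMinimal (Subgroup.closure {cs.simple a, cs.simple b}) w
  have hdX := IsLeftMinimal.isRightMinimal cs hd
    (fun r hr ↦ cs.inversionSign_eq_zero_of_notMem hu hr) hw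
  have hη : ∀ c : B, cs.FixesCoset X c d → cs.inversionSign u (cs.simple c) = 0 := by
    rintro c ⟨x, hx, hc⟩
    have := hw x hx
    rwa [inversionSign_mul, hdX x hx, zero_add, ← hc, mul_inv_cancel_right] at this
  have hpair : ({cs.simple b, cs.simple a} : Set W) = {cs.simple a, cs.simple b} :=
    Set.pair_comm _ _
  by_cases hfa : cs.FixesCoset X a d <;> by_cases hfb : cs.FixesCoset X b d
  · obtain rfl := cs.eq_one_of_inversionSign_eq_zero hab h0 hu (hη a hfa) (hη b hfb)
    obtain ⟨x, hx, ha⟩ := hfa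
    obtain ⟨y, hy, hb⟩ := hfb
    have hxy : x ≠ y := by
      rintro rfl
      exact hab (cs.simple_injective (mul_right_cancel (ha.trans hb.symm)))
    obtain ⟨h0', hc⟩ := hα x hx y hy hxy
    rw [one_mul, altProd_cosetPerm_of_mem cs α hx hy ha hb,
      altProd_cosetPerm_of_mem cs α hy hx hb ha, ← cs.matrix_eq_of_conj hab h0 hxy h0' ha hb, hc]
  · obtain ⟨k, hk, rfl⟩ := cs.exists_dihWord_eq_of_inversionSign_eq_zero hab h0 hu (hη a hfa)
    obtain ⟨x, hx, ha⟩ := hfa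
    exact cs.altProd_cosetPerm_dihWord α hab h0 hd hx ha hfb hk g
  · rw [← hpair] at hu hd
    rw [M.symmetric] at h0 ⊢
    obtain ⟨k, hk, rfl⟩ :=
      cs.exists_dihWord_eq_of_inversionSign_eq_zero hab.symm h0 hu (hη b hfb)
    obtain ⟨x, hx, hb⟩ := hfb
    exact (cs.altProd_cosetPerm_dihWord α hab.symm h0 hd hx hb hfa hk g).symm
  · have hnot : ∀ c, cs.simple c ∈ Subgroup.closure {cs.simple a, cs.simple b} →
        ∀ v ∈ Subgroup.closure {cs.simple a, cs.simple b}, ¬ cs.FixesCoset X c (v * d) := by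
      intro c hc v hv h
      rcases FixesCoset.inv_mul_mul_eq cs hab h0 hd hv hc h with ⟨-, h⟩ | ⟨-, h⟩
      · exact hfa h
      · exact hfb h
    have hna := hnot a cs.simple_mem_closure_pair_left
    have hnb := hnot b cs.simple_mem_closure_pair_right
    rw [altProd_cosetPerm_of_forall_not cs α (fun v hv ↦ ⟨hna v hv, hnb v hv⟩) hu,
      altProd_cosetPerm_of_forall_not cs α
        (fun v hv ↦ ⟨hnb v (hpair ▸ hv), hna v (hpair ▸ hv)⟩) (hpair ▸ hu),
      altProd_simple_comm]

end CoxeterSystem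

open Classical in
/-- The Coxeter matrix underlying an Artin exponent matrix; the value `0` encodes `∞`. -/
noncomputable def artinCoxeterMatrix {S : Type} (M : S → S → ℕ∞)
    (hsymm : ∀ s t, M s t = M t s) (h2 : ∀ s t, s ≠ t → 2 ≤ M s t) : CoxeterMatrix S where
  M := Matrix.of fun s t ↦ if s = t then 1 else (M s t).toNat
  isSymm := by
    ext s t
    simp only [Matrix.transpose_apply, Matrix.of_apply, hsymm t s, eq_comm (a := t)]
  diagonal s := by simp
  off_diagonal s t h := by
    have h1 := h2 s t h
    simp only [Matrix.of_apply, if_neg h]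
    intro h3
    generalize M s t = n at *
    cases n with
    | top => simp at h3
    | coe n =>
      simp at h3
      subst h3
      norm_num at h1

lemma artinCoxeterMatrix_apply {S : Type} {M : S → S → ℕ∞} (hsymm : ∀ s t, M s t = M t s)
    (h2 : ∀ s t, s ≠ t → 2 ≤ M s t) {s t : S} {m : ℕ} (hst : s ≠ t) (h : M s t = m) :
    artinCoxeterMatrix M hsymm h2 s t = m ∧ m ≠ 0 := by
  refine ⟨?_, ?_⟩
  · classical
    change (if s = t then 1 else (M s t).toNat) = m
    rw [if_neg hst, h, ENat.toNat_natCast]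
  · rintro rfl
    have := h2 s t hst
    rw [h] at this
    norm_num at this

section ArtinAction

variable {S : Type} {M : S → S → ℕ∞} (hsymm : ∀ s t, M s t = M t s)
  (h2 : ∀ s t, s ≠ t → 2 ≤ M s t) {A : Type*} [Group A] (X : Set S) (α : S → A)

/-- The action of an Artin generator on pairs of a right minimal element of the Coxeter group and
an element of `A`. -/
noncomputable def artinPerm (c : S) :
    Equiv.Perm {p : (artinCoxeterMatrix M hsymm h2).Group × A //
      (artinCoxeterMatrix M hsymm h2).toCoxeterSystem.IsRightMinimal X p.1} :=
  (CoxeterSystem.cosetPerm (artinCoxeterMatrix M hsymm h2).toCoxeterSystem X α c).subtypePerm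
    fun p ↦ CoxeterSystem.isRightMinimal_cosetPerm_iff _ α c p

lemma coe_altProd_artinPerm (a b : S) (n : ℕ)
    (p : {p : (artinCoxeterMatrix M hsymm h2).Group × A //
      (artinCoxeterMatrix M hsymm h2).toCoxeterSystem.IsRightMinimal X p.1}) :
    (altProd (artinPerm hsymm h2 X α a) (artinPerm hsymm h2 X α b) n p : _ × A) =
      altProd (CoxeterSystem.cosetPerm (artinCoxeterMatrix M hsymm h2).toCoxeterSystem X α a)
        (CoxeterSystem.cosetPerm (artinCoxeterMatrix M hsymm h2).toCoxeterSystem X α b) n p := by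
  induction n generalizing a b with
  | zero => rfl
  | succ n ih =>
    rw [altProd, altProd, Equiv.Perm.mul_apply, Equiv.Perm.mul_apply, ← ih]
    rfl

/-- The action of the Artin group on pairs of a right minimal element of the Coxeter group and an
element of `A`. -/
noncomputable def artinAction
    (hα : ∀ x ∈ X, ∀ y ∈ X, x ≠ y → artinCoxeterMatrix M hsymm h2 x y ≠ 0 ∧
      altProd (α x) (α y) (artinCoxeterMatrix M hsymm h2 x y) =
        altProd (α y) (α x) (artinCoxeterMatrix M hsymm h2 x y)) :
    ArtinGroup M →* Equiv.Perm {p : (artinCoxeterMatrix M hsymm h2).Group × A //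
      (artinCoxeterMatrix M hsymm h2).toCoxeterSystem.IsRightMinimal X p.1} :=
  PresentedGroup.toGroup (f := artinPerm hsymm h2 X α) <| by
    rintro r ⟨a, b, m, hab, hm, rfl⟩
    obtain ⟨hm', h0⟩ := artinCoxeterMatrix_apply hsymm h2 hab hm
    rw [map_mul, map_inv, map_altProd, map_altProd, FreeGroup.lift_apply_of,
      FreeGroup.lift_apply_of, mul_inv_eq_one]
    ext1 p
    apply Subtype.ext
    rw [coe_altProd_artinPerm, coe_altProd_artinPerm, ← hm']
    exact CoxeterSystem.altProd_cosetPerm_comm _ α hα hab (by rwa [hm']) p.2 p.1.2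

end ArtinAction

/-- Dihedral parabolics embed, for every pair of generators with a braid relation. -/
theorem artinGroup_injective_of_ne {S : Type} {M : S → S → ℕ∞}
    (hsymm : ∀ s t, M s t = M t s) (h2 : ∀ s t, s ≠ t → 2 ≤ M s t) {s t : S} {m : ℕ}
    (hst : s ≠ t) (hm : M s t = m) {φ : DihedralArtin m →* ArtinGroup M}
    (hs : φ (Dgen m 0) = Agen M s) (ht : φ (Dgen m 1) = Agen M t) : Function.Injective φ := by
  classical
  obtain ⟨hm1, h0⟩ := artinCoxeterMatrix_apply hsymm h2 hst hm
  obtain ⟨hm2, -⟩ := artinCoxeterMatrix_apply hsymm h2 hst.symm ((hsymm t s).trans hm)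
  let X : Set S := {s, t}
  let α : S → DihedralArtin m := fun u ↦ if u = s then Dgen m 0 else Dgen m 1
  have αs : α s = Dgen m 0 := if_pos rfl
  have αt : α t = Dgen m 1 := if_neg hst.symm
  have hbraid : altProd (Dgen m 0) (Dgen m 1) m = altProd (Dgen m 1) (Dgen m 0) m := by
    have h : PresentedGroup.mk (braidRels m) (altProd (FreeGroup.of 0) (FreeGroup.of 1) m *
        (altProd (FreeGroup.of 1) (FreeGroup.of 0) m)⁻¹) = 1 :=
      PresentedGroup.one_of_mem rfl
    rwa [map_mul, map_inv, mul_inv_eq_one, map_altProd, map_altProd] at h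
  have hα : ∀ x ∈ X, ∀ y ∈ X, x ≠ y → artinCoxeterMatrix M hsymm h2 x y ≠ 0 ∧
      altProd (α x) (α y) (artinCoxeterMatrix M hsymm h2 x y) =
        altProd (α y) (α x) (artinCoxeterMatrix M hsymm h2 x y) := by
    rintro x (rfl | rfl) y (rfl | rfl) hxy
    · exact absurd rfl hxy
    · rw [hm1, αs, αt]
      exact ⟨h0, hbraid⟩
    · rw [hm2, αs, αt]
      exact ⟨h0, hbraid.symm⟩
    · exact absurd rfl hxy
  let Ψ := artinAction hsymm h2 X α hα
  have hone : (artinCoxeterMatrix M hsymm h2).toCoxeterSystem.IsRightMinimal X 1 :=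
    fun x _ ↦ CoxeterSystem.inversionSign_one _ _
  have hΨ : ∀ u ∈ X, ∀ g : DihedralArtin m,
      Ψ (Agen M u) ⟨(1, g), hone⟩ = ⟨(1, α u * g), hone⟩ := by
    intro u hu g
    have h : Ψ (Agen M u) = artinPerm hsymm h2 X α u := PresentedGroup.toGroup.of _
    rw [h]
    exact Subtype.ext (CoxeterSystem.cosetPerm_of_mem _ α hu (by rw [mul_one, one_mul]) g)
  have key : ∀ g h : DihedralArtin m, Ψ (φ g) ⟨(1, h), hone⟩ = ⟨(1, g * h), hone⟩ := by
    intro g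
    have hg : g ∈ Subgroup.closure (Set.range (PresentedGroup.of (rels := braidRels m))) := by
      rw [PresentedGroup.closure_range_of]
      trivial
    induction hg using Subgroup.closure_induction with
    | mem x hx =>
      obtain ⟨i, rfl⟩ := hx
      intro h
      fin_cases i
      · have := hΨ s (by simp [X]) h
        rwa [αs, ← hs] at this
      · have := hΨ t (by simp [X]) h
        rwa [αt, ← ht] at this
    | one => simp
    | mul x y _ _ hx hy =>
      intro h
      rw [map_mul, map_mul, Equiv.Perm.mul_apply, hy, hx, mul_assoc]
    | inv x _ hx =>
      intro h
      rw [map_inv, map_inv, Equiv.Perm.inv_eq_iff_eq, hx, mul_inv_cancel_left]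
  rw [injective_iff_map_eq_one]
  intro g hg
  have h := key g 1
  rw [hg, map_one, Equiv.Perm.one_apply, mul_one] at h
  exact (congrArg (fun p ↦ p.1.2) h).symm

/-- The exponent sum, sending every generator of an Artin group to `1`. -/
def artinExponentSum {S : Type} (M : S → S → ℕ∞) : ArtinGroup M →* Multiplicative ℤ :=
  PresentedGroup.toGroup (f := fun _ ↦ Multiplicative.ofAdd 1) <| by
    rintro r ⟨a, b, m, -, -, rfl⟩
    rw [map_mul, map_inv, map_altProd, map_altProd, FreeGroup.lift_apply_of,
      FreeGroup.lift_apply_of, mul_inv_cancel]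

lemma artinExponentSum_gen {S : Type} (M : S → S → ℕ∞) (s : S) :
    artinExponentSum M (Agen M s) = Multiplicative.ofAdd 1 :=
  PresentedGroup.toGroup.of _

lemma artinGroup_zpow_injective {S : Type} (M : S → S → ℕ∞) (s : S) :
    Function.Injective fun k : ℤ ↦ Agen M s ^ k := by
  intro k l h
  have h := congrArg (artinExponentSum M) h
  simpa [artinExponentSum_gen, ← ofAdd_zsmul] using h

/-- In a two-dimensional Artin group `A_S` of hyperbolic type, every
dihedral parabolic on generators `s ≠ t` with `M s t = m < ∞` is the injective image of the
dihedral Artin group `A_m` under the canonical homomorphism (i.e. the one sending the two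
generators of `A_m` to the images of `s` and `t`), and every generator `s ∈ S` has infinite
order in `A_S`. -/
theorem artinGroup_dihedral_parabolics_embed {S : Type} (M : S → S → ℕ∞)
    (hsymm : ∀ s t, M s t = M t s)
    (h2 : ∀ s t, s ≠ t → 2 ≤ M s t)
    (hhyp : ∀ s t r : S, s ≠ t → t ≠ r → s ≠ r →
      expInv (M s t) + expInv (M t r) + expInv (M s r) < 1) :
    (∀ (s t : S) (m : ℕ), s ≠ t → M s t = (m : ℕ∞) →
      ∀ φ : DihedralArtin m →* ArtinGroup M,
        φ (Dgen m 0) = Agen M s → φ (Dgen m 1) = Agen M t → Function.Injective φ) ∧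
    (∀ s : S, Function.Injective fun k : ℤ => (Agen M s) ^ k) := by
  exact ⟨fun _ _ _ hst hm _ hs ht ↦ artinGroup_injective_of_ne hsymm h2 hst hm hs ht,
    artinGroup_zpow_injective M⟩
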